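/- (Lemma A2, ℓ∞-bound for the remainder term) Under Assumptions 1 and 2, if λ ≤ γ·c_min²/(100·c_b·(2−γ)·s·c_max) and ‖Xᵀε/n‖_∞ ≤ λ/4, then the Taylor remainder vector r satisfies ‖Xᵀr/n‖_∞ ≤ λ·γ/(4(2−γ)). -/

import Mathlib

open scoped BigOperators
open Matrix

noncomputable section

/-- Logistic function `ρ(u,v) = exp(uᵀv)/(1+exp(uᵀv))`. -/
def rho {ι : Type*} [Fintype ι] (u v : ι → ℝ) : ℝ :=
  Real.exp (u ⬝ᵥ v) / (1 + Real.exp (u ⬝ᵥ v))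

/-- `w(u,v) = exp(uᵀv)/(1+exp(uᵀv))²`. -/
def wFun {ι : Type*} [Fintype ι] (u v : ι → ℝ) : ℝ :=
  Real.exp (u ⬝ᵥ v) / (1 + Real.exp (u ⬝ᵥ v)) ^ 2

/-- The ℓ1-norm of a vector. -/
def l1norm {ι : Type*} [Fintype ι] (v : ι → ℝ) : ℝ := ∑ j, |v j|

/-- The ℓ2-norm of a vector. -/
def l2norm {ι : Type*} [Fintype ι] (v : ι → ℝ) : ℝ := Real.sqrt (∑ j, (v j) ^ 2)

/-- The ℓ∞-norm of a vector. -/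
def linfNorm {ι : Type*} [Fintype ι] (v : ι → ℝ) : ℝ := ⨆ j, |v j|

/-- The ℓ∞-to-ℓ∞ operator norm of a matrix: the maximum absolute row sum. -/
def opInf {ι κ : Type*} [Fintype ι] [Fintype κ] (M : Matrix ι κ ℝ) : ℝ :=
  ⨆ i, ∑ j, |M i j|

/-- The spectral norm (ℓ2-to-ℓ2 operator norm) of a matrix. -/
def op2 {ι κ : Type*} [Fintype ι] [Fintype κ] (M : Matrix ι κ ℝ) : ℝ :=
  sSup {c : ℝ | ∃ v : κ → ℝ, l2norm v = 1 ∧ c = l2norm (M *ᵥ v)}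

/-- The smallest eigenvalue of a symmetric matrix, as the infimum of its
Rayleigh quotient over unit vectors. -/
def eigMin {ι : Type*} [Fintype ι] (M : Matrix ι ι ℝ) : ℝ :=
  sInf {c : ℝ | ∃ v : ι → ℝ, l2norm v = 1 ∧ c = v ⬝ᵥ (M *ᵥ v)}

/-- The largest eigenvalue of a symmetric matrix, as the supremum of its
Rayleigh quotient over unit vectors. -/
def eigMax {ι : Type*} [Fintype ι] (M : Matrix ι ι ℝ) : ℝ :=
  sSup {c : ℝ | ∃ v : ι → ℝ, l2norm v = 1 ∧ c = v ⬝ᵥ (M *ᵥ v)}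

/-- The negative log-likelihood of the logistic regression model,
`L(β) = (1/n)·Σᵢ [log(1+exp(xᵢᵀβ)) − yᵢ·xᵢᵀβ]`. -/
def logLoss {n : ℕ} {ι : Type*} [Fintype ι] (X : Matrix (Fin n) ι ℝ)
    (y : Fin n → ℝ) (β : ι → ℝ) : ℝ :=
  (1 / (n : ℝ)) * ∑ i, (Real.log (1 + Real.exp (X i ⬝ᵥ β)) - y i * (X i ⬝ᵥ β))

/-- A function whose second derivative is at least `c` on a convex set lies above its quadratic
Taylor minorant there. -/
lemma taylor_quadratic_le {F F' F'' : ℝ → ℝ} {D : Set ℝ} {c : ℝ} (hD : Convex ℝ D)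
    (hF : ∀ x, HasDerivAt F (F' x) x) (hF' : ∀ x, HasDerivAt F' (F'' x) x)
    (hc : ∀ x ∈ D, c ≤ F'' x) {a b : ℝ} (ha : a ∈ D) (hb : b ∈ D) :
    F a + F' a * (b - a) + c / 2 * (b - a) ^ 2 ≤ F b := by
  have hG : ∀ x, HasDerivAt (fun x => F x - c / 2 * x ^ 2) (F' x - c * x) x := fun x => by
    refine ((hF x).sub (((hasDerivAt_id x).pow 2).const_mul (c / 2))).congr_deriv ?_
    simp
    ring
  have hG' : ∀ x, HasDerivAt (fun x => F' x - c * x) (F'' x - c) x := fun x => by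
    exact ((hF' x).sub ((hasDerivAt_id x).const_mul c)).congr_deriv (by simp)
  have hconv : ConvexOn ℝ D (fun x => F x - c / 2 * x ^ 2) :=
    convexOn_of_hasDerivWithinAt2_nonneg hD
      (fun x _ => (hG x).continuousAt.continuousWithinAt)
      (fun x _ => (hG x).hasDerivWithinAt) (fun x _ => (hG' x).hasDerivWithinAt)
      (fun x hx => sub_nonneg.2 (hc x (interior_subset hx)))
  have key : (F a - c / 2 * a ^ 2) + (F' a - c * a) * (b - a) ≤ F b - c / 2 * b ^ 2 := by
    rcases lt_trichotomy a b with h | h | h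
    · have := hconv.le_slope_of_hasDerivAt ha hb h (hG a)
      rw [slope_def_field, le_div_iff₀ (sub_pos.2 h)] at this
      linarith
    · subst h; simp
    · have := hconv.slope_le_of_hasDerivAt hb ha h (hG a)
      rw [slope_def_field, div_le_iff₀ (sub_pos.2 h)] at this
      linarith
  linarith [key]

lemma hasDerivAt_log_one_add_exp (t : ℝ) :
    HasDerivAt (fun t => Real.log (1 + Real.exp t)) (Real.exp t / (1 + Real.exp t)) t :=
  ((Real.hasDerivAt_exp t).const_add 1).log (by positivity)

lemma hasDerivAt_exp_div_one_add_exp (t : ℝ) :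
    HasDerivAt (fun t => Real.exp t / (1 + Real.exp t))
      (Real.exp t / (1 + Real.exp t) ^ 2) t := by
  refine ((Real.hasDerivAt_exp t).div ((Real.hasDerivAt_exp t).const_add 1)
    (by positivity)).congr_deriv ?_
  congr 1
  ring

lemma hasDerivAt_exp_div_one_add_exp_sq (t : ℝ) :
    HasDerivAt (fun t => Real.exp t / (1 + Real.exp t) ^ 2)
      (Real.exp t * (1 - Real.exp t) / (1 + Real.exp t) ^ 3) t := by
  have : 1 + Real.exp t ≠ 0 := by positivity
  refine ((Real.hasDerivAt_exp t).div (((Real.hasDerivAt_exp t).const_add 1).pow 2)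
    (pow_ne_zero 2 this)).congr_deriv ?_
  simp only [Pi.pow_apply]
  field_simp
  push_cast
  ring

lemma abs_exp_mul_one_sub_exp_div_le (t : ℝ) :
    |Real.exp t * (1 - Real.exp t) / (1 + Real.exp t) ^ 3| ≤ 1 := by
  have h := Real.exp_pos t
  rw [abs_div, abs_of_pos (by positivity : 0 < (1 + Real.exp t) ^ 3), div_le_one (by positivity),
    abs_le]
  constructor <;> nlinarith [pow_pos h 2, pow_pos h 3]

/-- Quadratic bound for the first-order Taylor remainder of the logistic function. -/
lemma abs_logistic_remainder_le (a b : ℝ) :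
    |Real.exp b / (1 + Real.exp b) - Real.exp a / (1 + Real.exp a)
      - Real.exp a / (1 + Real.exp a) ^ 2 * (b - a)| ≤ (b - a) ^ 2 / 2 := by
  have h1 := taylor_quadratic_le (c := -1) convex_univ hasDerivAt_exp_div_one_add_exp
    hasDerivAt_exp_div_one_add_exp_sq
    (fun x _ => (abs_le.1 (abs_exp_mul_one_sub_exp_div_le x)).1) (Set.mem_univ a) (Set.mem_univ b)
  have h2 := taylor_quadratic_le (c := -1) convex_univ
    (fun x => (hasDerivAt_exp_div_one_add_exp x).neg)
    (fun x => (hasDerivAt_exp_div_one_add_exp_sq x).neg)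
    (fun x _ => neg_le_neg (abs_le.1 (abs_exp_mul_one_sub_exp_div_le x)).2)
    (Set.mem_univ a) (Set.mem_univ b)
  simp only [Pi.neg_apply] at h2
  rw [abs_le]
  constructor <;> linarith

/-- The logistic weight loses at most a factor two on a ball of radius `1/2`. -/
lemma half_logistic_weight_le {a t : ℝ} (h : |t - a| ≤ 1 / 2) :
    Real.exp a / (1 + Real.exp a) ^ 2 / 2 ≤ Real.exp t / (1 + Real.exp t) ^ 2 := by
  obtain ⟨h1, h2⟩ := abs_le.1 h
  have ha := Real.exp_pos a
  have ht := Real.exp_pos t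
  have hl : Real.exp a ≤ 2 * Real.exp t := by
    have h3 : Real.exp t = Real.exp a * Real.exp (t - a) := by rw [← Real.exp_add]; ring_nf
    nlinarith [Real.add_one_le_exp (t - a)]
  have hu : Real.exp t ≤ 2 * Real.exp a := by
    have h3 : Real.exp a = Real.exp t * Real.exp (a - t) := by rw [← Real.exp_add]; ring_nf
    nlinarith [Real.add_one_le_exp (a - t)]
  rw [div_div, div_le_div_iff₀ (by positivity) (by positivity)]
  nlinarith [mul_nonneg (sub_nonneg.2 hl) (sub_nonneg.2 hu), mul_pos ha ht,
    mul_nonneg (mul_pos ha ht).le (sub_nonneg.2 hu), mul_nonneg (mul_pos ha ht).le (sub_nonneg.2 hl)]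

/-- Local strong convexity of `t ↦ log (1 + exp t)`. -/
lemma log_one_add_exp_quadratic_le {a b : ℝ} (h : |b - a| ≤ 1 / 2) :
    Real.log (1 + Real.exp a) + Real.exp a / (1 + Real.exp a) * (b - a)
      + Real.exp a / (1 + Real.exp a) ^ 2 / 4 * (b - a) ^ 2 ≤ Real.log (1 + Real.exp b) := by
  have := taylor_quadratic_le (D := Metric.closedBall a (1 / 2))
    (c := Real.exp a / (1 + Real.exp a) ^ 2 / 2)
    (convex_closedBall a _) hasDerivAt_log_one_add_exp hasDerivAt_exp_div_one_add_exp
    (fun x hx => half_logistic_weight_le (by simpa [Real.dist_eq] using hx))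
    (a := a) (b := b) (by simp) (by simpa [Real.dist_eq] using h)
  linarith

lemma convexOn_log_one_add_exp :
    ConvexOn ℝ Set.univ (fun t => Real.log (1 + Real.exp t)) :=
  convexOn_of_hasDerivWithinAt2_nonneg convex_univ
    (fun x _ => (hasDerivAt_log_one_add_exp x).continuousAt.continuousWithinAt)
    (fun x _ => (hasDerivAt_log_one_add_exp x).hasDerivWithinAt)
    (fun x _ => (hasDerivAt_exp_div_one_add_exp x).hasDerivWithinAt)
    (fun x _ => by positivity)

/-- The logistic loss is convex along segments. -/
lemma logLoss_add_smul_le {n : ℕ} {ι : Type*} [Fintype ι] (X : Matrix (Fin n) ι ℝ)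
    (y : Fin n → ℝ) (b u : ι → ℝ) {t : ℝ} (ht0 : 0 ≤ t) (ht1 : t ≤ 1) :
    logLoss X y (b + t • u) ≤ (1 - t) * logLoss X y b + t * logLoss X y (b + u) := by
  unfold logLoss
  rw [mul_left_comm, mul_left_comm t, ← mul_add, Finset.mul_sum (a := 1 - t),
    Finset.mul_sum (a := t),
    ← Finset.sum_add_distrib]
  refine mul_le_mul_of_nonneg_left (Finset.sum_le_sum fun i _ => ?_) (by positivity)
  have h := convexOn_log_one_add_exp.2 (Set.mem_univ (X i ⬝ᵥ b)) (Set.mem_univ (X i ⬝ᵥ (b + u)))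
    (sub_nonneg.2 ht1) ht0 (by ring)
  simp only [smul_eq_mul, dotProduct_add, dotProduct_smul] at h ⊢
  rw [show (1 - t) * (X i ⬝ᵥ b) + t * (X i ⬝ᵥ b + X i ⬝ᵥ u) = X i ⬝ᵥ b + t * (X i ⬝ᵥ u) by
    ring] at h
  linarith

lemma l1norm_nonneg {ι : Type*} [Fintype ι] (u : ι → ℝ) : 0 ≤ l1norm u :=
  Finset.sum_nonneg fun _ _ => abs_nonneg _

lemma l1norm_add_le {ι : Type*} [Fintype ι] (u v : ι → ℝ) :
    l1norm (u + v) ≤ l1norm u + l1norm v := by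
  unfold l1norm
  rw [← Finset.sum_add_distrib]
  exact Finset.sum_le_sum fun j _ => abs_add_le _ _

lemma l1norm_smul {ι : Type*} [Fintype ι] (t : ℝ) (u : ι → ℝ) :
    l1norm (t • u) = |t| * l1norm u := by
  simp [l1norm, abs_mul, Finset.mul_sum]

lemma l1norm_sq_le {ι : Type*} [Fintype ι] (u : ι → ℝ) :
    l1norm u ^ 2 ≤ Fintype.card ι * ∑ j, u j ^ 2 := by
  simpa [l1norm] using sq_sum_le_card_mul_sum_sq (s := Finset.univ) (f := fun j => |u j|)

lemma abs_dotProduct_le_mul_l1norm {ι : Type*} [Fintype ι] {x : ι → ℝ} {c : ℝ}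
    (hx : ∀ j, |x j| ≤ c) (u : ι → ℝ) : |x ⬝ᵥ u| ≤ c * l1norm u := by
  unfold l1norm dotProduct
  rw [Finset.mul_sum]
  refine (Finset.abs_sum_le_sum_abs _ _).trans (Finset.sum_le_sum fun j _ => ?_)
  rw [abs_mul]
  exact mul_le_mul_of_nonneg_right (hx j) (abs_nonneg _)

lemma abs_le_linfNorm {ι : Type*} [Fintype ι] (v : ι → ℝ) (j : ι) : |v j| ≤ linfNorm v :=
  le_ciSup (f := fun j => |v j|) (Set.finite_range _).bddAbove j

/-- Every nonzero vector is a multiple of a unit vector with proportional quadratic form. -/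
lemma exists_unit_rayleigh {ι : Type*} [Fintype ι] (M : Matrix ι ι ℝ) {u : ι → ℝ}
    (hu : 0 < ∑ j, u j ^ 2) :
    ∃ v : ι → ℝ, l2norm v = 1 ∧ v ⬝ᵥ (M *ᵥ v) = u ⬝ᵥ (M *ᵥ u) / ∑ j, u j ^ 2 := by
  have hsq : Real.sqrt (∑ j, u j ^ 2) ^ 2 = ∑ j, u j ^ 2 := Real.sq_sqrt hu.le
  refine ⟨(Real.sqrt (∑ j, u j ^ 2))⁻¹ • u, ?_, ?_⟩
  · simp [l2norm, mul_pow, ← Finset.mul_sum, inv_mul_cancel₀ hu.ne', hsq]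
  · rw [mulVec_smul, dotProduct_smul, smul_dotProduct, smul_eq_mul, smul_eq_mul, ← mul_assoc,
      ← sq, inv_pow, hsq, inv_mul_eq_div]

lemma eigMin_mul_le {ι : Type*} [Fintype ι] {M : Matrix ι ι ℝ} (hM : 0 < eigMin M) (u : ι → ℝ) :
    eigMin M * ∑ j, u j ^ 2 ≤ u ⬝ᵥ (M *ᵥ u) := by
  rcases (Finset.sum_nonneg fun j _ => sq_nonneg (u j) : 0 ≤ ∑ j, u j ^ 2).eq_or_lt with h | h
  · have hu : u = 0 := by
      funext j
      simpa using (Finset.sum_eq_zero_iff_of_nonneg fun j _ => sq_nonneg (u j)).1 h.symm j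
        (Finset.mem_univ j)
    simp [hu]
  · obtain ⟨v, hv, hvM⟩ := exists_unit_rayleigh M h
    rw [← le_div_iff₀ h, ← hvM]
    refine csInf_le ?_ ⟨v, hv, rfl⟩
    by_contra hb
    exact hM.ne' (Real.sInf_of_not_bddBelow hb)

lemma le_eigMax_mul {ι : Type*} [Fintype ι] {M : Matrix ι ι ℝ} (hM : 0 < eigMax M) (u : ι → ℝ) :
    u ⬝ᵥ (M *ᵥ u) ≤ eigMax M * ∑ j, u j ^ 2 := by
  rcases (Finset.sum_nonneg fun j _ => sq_nonneg (u j) : 0 ≤ ∑ j, u j ^ 2).eq_or_lt with h | h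
  · have hu : u = 0 := by
      funext j
      simpa using (Finset.sum_eq_zero_iff_of_nonneg fun j _ => sq_nonneg (u j)).1 h.symm j
        (Finset.mem_univ j)
    simp [hu]
  · obtain ⟨v, hv, hvM⟩ := exists_unit_rayleigh M h
    rw [← div_le_iff₀ h, ← hvM]
    refine le_csSup ?_ ⟨v, hv, rfl⟩
    by_contra hb
    exact hM.ne' (Real.sSup_of_not_bddAbove hb)

lemma dotProduct_weighted_gram_mulVec {m ι : Type*} [Fintype m] [DecidableEq m] [Fintype ι]
    (c : ℝ) (X : Matrix m ι ℝ) (d : m → ℝ) (u : ι → ℝ) :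
    u ⬝ᵥ ((c • (Xᵀ * Matrix.diagonal d * X)) *ᵥ u) = c * ∑ i, d i * (X i ⬝ᵥ u) ^ 2 := by
  rw [smul_mulVec, dotProduct_smul, smul_eq_mul, ← mulVec_mulVec, ← mulVec_mulVec,
    dotProduct_mulVec, vecMul_transpose]
  congr 1
  refine Finset.sum_congr rfl fun i _ => ?_
  rw [mulVec_diagonal]
  simp only [mulVec]
  ring

lemma sum_univ_eq_sum_subtype_of_zero {ι : Type*} [Fintype ι] (S : Finset ι) (g : ι → ℝ)
    (hg : ∀ j, j ∉ S → g j = 0) : ∑ j, g j = ∑ j : {j // j ∈ S}, g j.1 := by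
  rw [Finset.sum_coe_sort S g]
  exact (Finset.sum_subset (Finset.subset_univ S) fun j _ hj => hg j hj).symm

/-- Points of the sublevel set of the penalized loss close to `b` satisfy the cone-type bound
`c ‖u‖₂² ≤ 5 λ ‖u‖₁`. -/
lemma sq_norm_le_of_penalized_loss_le {n : ℕ} {ι : Type*} [Fintype ι] {X : Matrix (Fin n) ι ℝ}
    {y : Fin n → ℝ} {b u : ι → ℝ} {cb c lam : ℝ} (hX : ∀ i j, |X i j| ≤ cb)
    (hc : c * ∑ j, u j ^ 2 ≤ 1 / (n : ℝ) * ∑ i, wFun (X i) b * (X i ⬝ᵥ u) ^ 2)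
    (hlam : 0 ≤ lam)
    (hgrad : ∀ j, |((1 / (n : ℝ)) • (Xᵀ *ᵥ fun i => y i - rho (X i) b)) j| ≤ lam / 4)
    (hu : cb * l1norm u ≤ 1 / 2)
    (hle : logLoss X y (b + u) + lam * l1norm (b + u) ≤ logLoss X y b + lam * l1norm b) :
    c * ∑ j, u j ^ 2 ≤ 5 * lam * l1norm u := by
  have hscore : 1 / (n : ℝ) * ∑ i, (y i - rho (X i) b) * (X i ⬝ᵥ u) ≤ lam / 4 * l1norm u := by
    refine le_trans (le_of_eq ?_) ((le_abs_self _).trans (abs_dotProduct_le_mul_l1norm hgrad u))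
    rw [smul_dotProduct, smul_eq_mul, mulVec_transpose, ← dotProduct_mulVec]
    rfl
  have hloss : logLoss X y b - 1 / (n : ℝ) * ∑ i, (y i - rho (X i) b) * (X i ⬝ᵥ u)
      + 1 / 4 * (1 / (n : ℝ) * ∑ i, wFun (X i) b * (X i ⬝ᵥ u) ^ 2) ≤ logLoss X y (b + u) := by
    unfold logLoss
    rw [mul_left_comm (1 / 4 : ℝ), ← mul_sub, ← mul_add, Finset.mul_sum (a := (1 / 4 : ℝ)),
      ← Finset.sum_sub_distrib, ← Finset.sum_add_distrib]
    refine mul_le_mul_of_nonneg_left (Finset.sum_le_sum fun i _ => ?_) (by positivity)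
    have h := log_one_add_exp_quadratic_le (a := X i ⬝ᵥ b) (b := X i ⬝ᵥ (b + u))
      (by
        rw [dotProduct_add, add_sub_cancel_left]
        exact (abs_dotProduct_le_mul_l1norm (hX i) u).trans hu)
    rw [dotProduct_add, add_sub_cancel_left] at h
    simp only [rho, wFun, dotProduct_add]
    linarith
  have htri : l1norm b ≤ l1norm (b + u) + l1norm u := by
    have h := l1norm_add_le (b + u) ((-1 : ℝ) • u)
    rw [l1norm_smul] at h
    simpa using h
  have := mul_le_mul_of_nonneg_left htri hlam
  linarith

/-- Squared `ℓ²` estimation error of a penalized estimator `b + Δ` in the low-noise regime. -/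
lemma sq_norm_minimizer_sub_le {n : ℕ} {ι : Type*} [Fintype ι] {XS : Matrix (Fin n) ι ℝ}
    {y : Fin n → ℝ} {b Δ : ι → ℝ} {c_b cmin lam : ℝ} (hcb : 0 < c_b)
    (hXSb : ∀ i j, |XS i j| ≤ c_b) (hA1 : 0 < cmin)
    (hmin : ∀ u : ι → ℝ,
      cmin * ∑ j, u j ^ 2 ≤ 1 / (n : ℝ) * ∑ i, wFun (XS i) b * (XS i ⬝ᵥ u) ^ 2)
    (hlam : 0 < lam)
    (hgrad : ∀ j, |((1 / (n : ℝ)) • (XSᵀ *ᵥ fun i => y i - rho (XS i) b)) j| ≤ lam / 4)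
    (hscale : 100 * c_b * lam * Fintype.card ι ≤ cmin)
    (hopt : logLoss XS y (b + Δ) + lam * l1norm (b + Δ) ≤ logLoss XS y b + lam * l1norm b) :
    cmin ^ 2 * ∑ j, Δ j ^ 2 ≤ 25 * lam ^ 2 * Fintype.card ι := by
  have hcard : (0 : ℝ) ≤ Fintype.card ι := Nat.cast_nonneg _
  have hl1 : ∀ u : ι → ℝ, cmin * ∑ j, u j ^ 2 ≤ 5 * lam * l1norm u →
      c_b * l1norm u < 1 / 2 := fun u hu => by
    have h1 := l1norm_sq_le u
    have h0 := l1norm_nonneg u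
    rcases h0.eq_or_lt with h | h
    · rw [← h]; norm_num
    have h2 : cmin * l1norm u ≤ 5 * lam * Fintype.card ι := by
      refine le_of_mul_le_mul_right ?_ h
      nlinarith [mul_le_mul_of_nonneg_left h1 hA1.le, mul_le_mul_of_nonneg_left hu hcard]
    have h3 : cmin * (c_b * l1norm u) ≤ cmin * (1 / 20) := by
      nlinarith [mul_le_mul_of_nonneg_left h2 hcb.le]
    linarith [le_of_mul_le_mul_left h3 hA1]
  have hloc : c_b * l1norm Δ ≤ 1 / 2 := by
    by_contra! hbig
    have hN : 0 < l1norm Δ := pos_of_mul_pos_right (by linarith) hcb.le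
    set t : ℝ := 1 / (2 * (c_b * l1norm Δ)) with ht
    have ht0 : 0 < t := by positivity
    have ht1 : t ≤ 1 := by
      rw [ht, div_le_one (by positivity)]
      linarith
    have hnorm : c_b * l1norm (t • Δ) = 1 / 2 := by
      rw [l1norm_smul, abs_of_pos ht0, ht]
      field_simp
    have hpen : l1norm (b + t • Δ) ≤ (1 - t) * l1norm b + t * l1norm (b + Δ) := by
      have h := l1norm_add_le ((1 - t) • b) (t • (b + Δ))
      rw [l1norm_smul, l1norm_smul, abs_of_pos ht0, abs_of_nonneg (sub_nonneg.2 ht1)] at h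
      rwa [show (1 - t) • b + t • (b + Δ) = b + t • Δ by module] at h
    have hconv := logLoss_add_smul_le XS y b Δ ht0.le ht1
    have hsub : logLoss XS y (b + t • Δ) + lam * l1norm (b + t • Δ)
        ≤ logLoss XS y b + lam * l1norm b := by
      nlinarith [mul_le_mul_of_nonneg_left hpen hlam.le, mul_le_mul_of_nonneg_left hopt ht0.le]
    exact (hl1 _
      (sq_norm_le_of_penalized_loss_le hXSb (hmin _) hlam.le hgrad hnorm.le hsub)).ne hnorm
  have hΔ2 : cmin * ∑ j, Δ j ^ 2 ≤ 5 * lam * l1norm Δ :=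
    sq_norm_le_of_penalized_loss_le hXSb (hmin _) hlam.le hgrad hloc hopt
  rcases (Finset.sum_nonneg fun j _ => sq_nonneg (Δ j) : 0 ≤ ∑ j, Δ j ^ 2).eq_or_lt with h | h
  · rw [← h, mul_zero]; positivity
  have h1 := l1norm_sq_le Δ
  have h2 : (cmin * ∑ j, Δ j ^ 2) ^ 2 ≤ (5 * lam * l1norm Δ) ^ 2 :=
    pow_le_pow_left₀ (by positivity) hΔ2 2
  refine le_of_mul_le_mul_right ?_ h
  nlinarith [mul_le_mul_of_nonneg_left h1 (by positivity : 0 ≤ 25 * lam ^ 2)]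

theorem linf_bound_remainder
    (n p : ℕ) (X : Matrix (Fin n) (Fin p) ℝ) (y : Fin n → ℝ)
    (hy : ∀ i, y i = 0 ∨ y i = 1)
    (c_b : ℝ) (hcb : 0 < c_b) (hXb : ∀ i j, |X i j| ≤ c_b)
    (βs : Fin p → ℝ) (S : Finset (Fin p)) (hS : ∀ j, j ∈ S ↔ βs j ≠ 0)
    (s : ℕ) (hs : s = S.card)
    (W : Matrix (Fin n) (Fin n) ℝ)
    (hW : W = Matrix.diagonal fun i => wFun (X i) βs)
    (XS : Matrix (Fin n) {j // j ∈ S} ℝ) (hXS : ∀ i j, XS i j = X i j.1)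
    (XSc : Matrix (Fin n) {j // j ∉ S} ℝ) (hXSc : ∀ i j, XSc i j = X i j.1)
    (cmin : ℝ) (hcmin : cmin = eigMin ((1 / (n : ℝ)) • (XSᵀ * W * XS)))
    (hA1 : 0 < cmin)
    (cmax : ℝ) (hcmax : cmax = eigMax ((1 / (n : ℝ)) • (Xᵀ * X)))
    (γ : ℝ) (hγ : γ = 1 - opInf ((XSᵀ * W * XS)⁻¹ * (XSᵀ * W * XSc)))
    (hA2 : 0 < γ)
    (ε : Fin n → ℝ) (hε : ∀ i, ε i = y i - rho (X i) βs)
    (lam : ℝ) (hlam : 0 < lam)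
    (hlamub : lam ≤ γ * cmin ^ 2 / (100 * c_b * (2 - γ) * (s : ℝ) * cmax))
    (hεb : linfNorm ((1 / (n : ℝ)) • (Xᵀ *ᵥ ε)) ≤ lam / 4)
    (αS : {j // j ∈ S} → ℝ)
    (hαS : ∀ θ : {j // j ∈ S} → ℝ,
      logLoss XS y αS + lam * l1norm αS ≤ logLoss XS y θ + lam * l1norm θ)
    (r : Fin n → ℝ)
    (hr : ∀ i, r i = rho (XS i) αS - rho (XS i) (fun j => βs j.1)
      - wFun (XS i) (fun j => βs j.1) * (XS i ⬝ᵥ (fun j => αS j - βs j.1))) :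
    linfNorm ((1 / (n : ℝ)) • (Xᵀ *ᵥ r)) ≤ lam * γ / (4 * (2 - γ)) := by
  have hwpos : ∀ i, 0 ≤ wFun (X i) βs := fun i => by unfold wFun; positivity
  have hwle : ∀ i, wFun (X i) βs ≤ 1 := fun i => by
    unfold wFun
    have := Real.exp_pos (X i ⬝ᵥ βs)
    rw [div_le_one (by positivity)]
    nlinarith
  have hγ1 : γ ≤ 1 := by
    have : 0 ≤ opInf ((XSᵀ * W * XS)⁻¹ * (XSᵀ * W * XSc)) :=
      Real.iSup_nonneg fun i => Finset.sum_nonneg fun j _ => abs_nonneg _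
    linarith
  have h2γ : 0 < 2 - γ := by linarith
  have hden : 0 < 100 * c_b * (2 - γ) * (s : ℝ) * cmax :=
    (div_pos_iff_of_pos_left (by positivity)).1 (hlam.trans_le hlamub)
  have hspos : 0 < (s : ℝ) := by
    rcases (Nat.cast_nonneg s : (0 : ℝ) ≤ s).eq_or_lt with h | h
    · simp [← h] at hden
    · exact h
  have hcmaxpos : 0 < cmax := pos_of_mul_pos_right hden (by positivity)
  have hcard : (Fintype.card {j // j ∈ S} : ℝ) = s := by simp [hs]
  have hXSb : ∀ i j, |XS i j| ≤ c_b := fun i j => by rw [hXS]; exact hXb _ _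
  set b : {j // j ∈ S} → ℝ := fun j => βs j.1 with hb
  have hdot : ∀ i, X i ⬝ᵥ βs = XS i ⬝ᵥ b := fun i => by
    simp only [dotProduct, hb, hXS]
    refine sum_univ_eq_sum_subtype_of_zero S (fun j => X i j * βs j) fun j hj => ?_
    have : βs j = 0 := by_contra fun h => hj ((hS j).2 h)
    simp [this]
  have hwS : ∀ i, wFun (X i) βs = wFun (XS i) b := fun i => by simp only [wFun, hdot]
  have hmin : ∀ u : {j // j ∈ S} → ℝ,
      cmin * ∑ j, u j ^ 2 ≤ 1 / (n : ℝ) * ∑ i, wFun (XS i) b * (XS i ⬝ᵥ u) ^ 2 := fun u => by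
    have h := eigMin_mul_le (hcmin ▸ hA1) u
    rw [← hcmin, hW, dotProduct_weighted_gram_mulVec] at h
    simpa only [hwS] using h
  have hmax : ∀ u : {j // j ∈ S} → ℝ,
      1 / (n : ℝ) * ∑ i, (XS i ⬝ᵥ u) ^ 2 ≤ cmax * ∑ j, u j ^ 2 := fun u => by
    have h := le_eigMax_mul (hcmax ▸ hcmaxpos) (fun j => if hj : j ∈ S then u ⟨j, hj⟩ else 0)
    rw [← hcmax, ← Matrix.mul_one Xᵀ, ← Matrix.diagonal_one, dotProduct_weighted_gram_mulVec,
      sum_univ_eq_sum_subtype_of_zero S _ (fun j hj => by simp [hj])] at h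
    have hu : ∀ i, X i ⬝ᵥ (fun j => if hj : j ∈ S then u ⟨j, hj⟩ else 0) = XS i ⬝ᵥ u := fun i => by
      simp only [dotProduct, hXS]
      rw [sum_univ_eq_sum_subtype_of_zero S _ (fun j hj => by simp [hj])]
      simp
    simpa [hu] using h
  have hgrad : ∀ j, |((1 / (n : ℝ)) • (XSᵀ *ᵥ fun i => y i - rho (XS i) b)) j| ≤ lam / 4 :=
    fun j => by
      refine le_trans (le_of_eq ?_) ((abs_le_linfNorm _ j.1).trans hεb)
      have he : ε = fun i => y i - rho (XS i) b := by
        funext i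
        simp only [hε, rho, hdot]
      rw [he]
      simp only [Pi.smul_apply, mulVec, dotProduct, transpose_apply, hXS]
  set Δ : {j // j ∈ S} → ℝ := fun j => αS j - βs j.1 with hΔ
  have hα : b + Δ = αS := by funext j; simp [hb, hΔ]
  have hopt := hαS b
  have hminmax : cmin ≤ cmax := by
    have hne : 0 < ∑ _j : {j // j ∈ S}, (1 : ℝ) ^ 2 := by simpa [hcard, ← hs] using hspos
    refine le_of_mul_le_mul_right ((hmin fun _ => 1).trans (le_trans ?_ (hmax fun _ => 1))) hne
    refine mul_le_mul_of_nonneg_left (Finset.sum_le_sum fun i _ => ?_) (by positivity)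
    exact mul_le_of_le_one_left (sq_nonneg _) (hwS i ▸ hwle i)
  have hlam' : lam * (100 * c_b * (2 - γ) * s * cmax) ≤ γ * cmin ^ 2 := (le_div_iff₀ hden).1 hlamub
  have hscale : 100 * c_b * lam * s ≤ cmin := by
    have h1 : (100 * c_b * lam * s * cmin) * 1 ≤ (100 * c_b * lam * s * cmax) * (2 - γ) := by
      gcongr
      linarith
    have h2 : γ * cmin ^ 2 ≤ 1 * cmin ^ 2 := by gcongr
    refine le_of_mul_le_mul_right ?_ hA1
    nlinarith
  have hQ : cmin ^ 2 * ∑ j, Δ j ^ 2 ≤ 25 * lam ^ 2 * s := by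
    have h := sq_norm_minimizer_sub_le hcb hXSb hA1 hmin hlam hgrad (by rwa [hcard])
      (Δ := Δ) (by rw [hα]; exact hopt)
    rwa [hcard] at h
  have hrb : ∀ i, |r i| ≤ (XS i ⬝ᵥ Δ) ^ 2 / 2 := fun i => by
    have h := abs_logistic_remainder_le (XS i ⬝ᵥ b) (XS i ⬝ᵥ αS)
    have hd : XS i ⬝ᵥ αS - XS i ⬝ᵥ b = XS i ⬝ᵥ Δ := by
      rw [← hα, dotProduct_add, add_sub_cancel_left]
    rw [hd] at h
    rw [hr]
    exact h
  refine Real.iSup_le (fun j => ?_) (by positivity)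
  have hj : |((1 / (n : ℝ)) • (Xᵀ *ᵥ r)) j| ≤ c_b / 2 * (cmax * ∑ j, Δ j ^ 2) := by
    refine le_trans ?_ (mul_le_mul_of_nonneg_left (hmax Δ) (by positivity))
    rw [Pi.smul_apply, smul_eq_mul, abs_mul, abs_of_nonneg (by positivity : 0 ≤ 1 / (n : ℝ)),
      mul_left_comm, Finset.mul_sum]
    refine mul_le_mul_of_nonneg_left ?_ (by positivity)
    rw [mulVec, dotProduct]
    refine (Finset.abs_sum_le_sum_abs _ _).trans (Finset.sum_le_sum fun i _ => ?_)
    rw [abs_mul, transpose_apply]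
    refine (mul_le_mul (hXb i j) (hrb i) (abs_nonneg _) hcb.le).trans (le_of_eq ?_)
    ring
  refine hj.trans ?_
  rw [le_div_iff₀ (by positivity)]
  have hcm : 0 < cmin ^ 2 := by positivity
  refine le_of_mul_le_mul_right ?_ hcm
  have h1 := mul_le_mul_of_nonneg_left hQ (by positivity : 0 ≤ 2 * c_b * cmax * (2 - γ))
  have h2 := mul_le_mul_of_nonneg_left hlam' (by positivity : 0 ≤ lam)
  have h3 : 0 < lam * (γ * cmin ^ 2) := by positivity
  nlinarith
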